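/- Let A be the subring of K generated by c_1, c_2, c_3, c_4, c_5. If y ∈ A is a nonnegative Laurent polynomial in (c_i, c_{i+1}) for every i ∈ ℤ/5ℤ, then y can be written as a finite ℕ-linear combination of cluster monomials c_i^p·c_{i+1}^q. (This is property (A3) of the theorem that cluster monomials form the atomic basis of a cluster algebra of type A, in the case n = 2.) -/

import Mathlib

noncomputable section

/-- The ambient field `K = ℚ(a,b)`, the field of rational functions in two
independent variables over `ℚ`. -/
abbrev K : Type := FractionRing (MvPolynomial (Fin 2) ℚ)

/-- The first variable `a`. -/
def a : K := algebraMap (MvPolynomial (Fin 2) ℚ) K (MvPolynomial.X 0)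

/-- The second variable `b`. -/
def b : K := algebraMap (MvPolynomial (Fin 2) ℚ) K (MvPolynomial.X 1)

/-- The five cluster variables of the coefficient-free cluster algebra of type
`A_2`, indexed by `ℤ/5ℤ`: `c_1 = a`, `c_2 = b`, `c_3 = (1+b)/a`,
`c_4 = (1+a+b)/(a·b)`, `c_5 = c_0 = (1+a)/b`. -/
def cA (i : ZMod 5) : K :=
  if i = 1 then a
  else if i = 2 then b
  else if i = 3 then (1 + b) / a
  else if i = 4 then (1 + a + b) / (a * b)
  else (1 + a) / b

/-- `y ∈ K` is a nonnegative Laurent polynomial in `(u, v)`: there are `k, l ∈ ℕ`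
and a two-variable polynomial `P` with nonnegative integer coefficients such that
`y·u^k·v^l = P(u,v)`. -/
def IsNonnegLaurent (u v y : K) : Prop :=
  ∃ (k l : ℕ) (P : MvPolynomial (Fin 2) ℕ),
    y * u ^ k * v ^ l = MvPolynomial.eval₂ (Nat.castRingHom K) ![u, v] P

/-- The set of cluster monomials of the type `A_2` cluster algebra. -/
def clusterMonomials : Set K :=
  {y | ∃ (i : ZMod 5) (p q : ℕ), y = cA i ^ p * cA (i + 1) ^ q}

open MvPolynomial

/-! ### Exchange relations and straightening -/

theorem a_ne_zero : a ≠ 0 := by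
  simp [a]

theorem b_ne_zero : b ≠ 0 := by
  simp [b]

/-- The exchange relation `c_i c_{i+2} = 1 + c_{i+1}`. -/
theorem cA_exchange (i : ZMod 5) : cA i * cA (i + 2) = 1 + cA (i + 1) := by
  have ha := a_ne_zero
  have hb := b_ne_zero
  have h0 : cA 0 = (1 + a) / b := rfl
  have h1 : cA 1 = a := rfl
  have h2 : cA 2 = b := rfl
  have h3 : cA 3 = (1 + b) / a := rfl
  have h4 : cA 4 = (1 + a + b) / (a * b) := rfl
  fin_cases i
  · change cA 0 * cA 2 = 1 + cA 1
    rw [h0, h1, h2]; field_simp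
  · change cA 1 * cA 3 = 1 + cA 2
    rw [h1, h2, h3]; field_simp
  · change cA 2 * cA 4 = 1 + cA 3
    rw [h2, h3, h4]; field_simp; ring
  · change cA 3 * cA 0 = 1 + cA 4
    rw [h3, h4, h0]; field_simp; ring
  · change cA 4 * cA 1 = 1 + cA 0
    rw [h4, h0, h1]; field_simp; ring

theorem cA_exchange_add_three (i : ZMod 5) : cA (i + 3) * cA i = 1 + cA (i + 4) := by
  have h := cA_exchange (i + 3)
  rwa [show i + 3 + 2 = i by rw [add_assoc]; exact add_zero i,
    show i + 3 + 1 = i + 4 by rw [add_assoc]; rfl] at h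

theorem cA_exchange_add_four (i : ZMod 5) : cA (i + 4) * cA (i + 1) = 1 + cA i := by
  have h := cA_exchange (i + 4)
  rwa [show i + 4 + 2 = i + 1 by rw [add_assoc]; rfl,
    show i + 4 + 1 = i by rw [add_assoc]; exact add_zero i] at h

theorem cA_exchange_add_one (i : ZMod 5) : cA (i + 1) * cA (i + 3) = 1 + cA (i + 2) := by
  have h := cA_exchange (i + 1)
  rwa [show i + 1 + 2 = i + 3 by rw [add_assoc]; rfl,
    show i + 1 + 1 = i + 2 by rw [add_assoc]; rfl] at h

theorem cA_ne_zero (i : ZMod 5) : cA i ≠ 0 := by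
  have hX : ∀ p : MvPolynomial (Fin 2) ℚ, eval 1 p ≠ 0 → algebraMap _ K p ≠ 0 := by
    intro p hp h
    rw [FaithfulSMul.algebraMap_eq_zero_iff] at h
    simp [h] at hp
  have ha := a_ne_zero
  have hb := b_ne_zero
  have h1a : 1 + a ≠ 0 := by
    have h := hX (1 + X 0) (by norm_num)
    rwa [map_add, map_one] at h
  have h1b : 1 + b ≠ 0 := by
    have h := hX (1 + X 1) (by norm_num)
    rwa [map_add, map_one] at h
  have h1ab : 1 + a + b ≠ 0 := by
    have h := hX (1 + X 0 + X 1) (by norm_num)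
    rwa [map_add, map_add, map_one] at h
  unfold cA
  split_ifs <;> positivity

theorem ZMod.five_eq_add (i j : ZMod 5) :
    j = i ∨ j = i + 1 ∨ j = i + 2 ∨ j = i + 3 ∨ j = i + 4 := by
  revert i j; decide

/-- The `ℤ`-module spanned by the cluster monomials. -/
abbrev clusterSpan : Submodule ℤ K := Submodule.span ℤ clusterMonomials

theorem monomial_mem_clusterSpan (i : ZMod 5) (p q : ℕ) :
    cA i ^ p * cA (i + 1) ^ q ∈ clusterSpan :=
  Submodule.subset_span ⟨i, p, q, rfl⟩

theorem cA_add_two_mul_mem (i : ZMod 5) (p q : ℕ) :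
    cA (i + 2) * (cA i ^ p * cA (i + 1) ^ q) ∈ clusterSpan := by
  rcases p with _ | p
  · have h := monomial_mem_clusterSpan (i + 1) q 1
    rw [show i + 1 + 1 = i + 2 by rw [add_assoc]; rfl] at h
    convert h using 1; ring
  · convert add_mem (monomial_mem_clusterSpan i p q) (monomial_mem_clusterSpan i p (q + 1)) using 1
    linear_combination cA i ^ p * cA (i + 1) ^ q * cA_exchange i

theorem cA_add_four_mul_mem (i : ZMod 5) (p q : ℕ) :
    cA (i + 4) * (cA i ^ p * cA (i + 1) ^ q) ∈ clusterSpan := by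
  rcases q with _ | q
  · have h := monomial_mem_clusterSpan (i + 4) 1 p
    rw [show i + 4 + 1 = i by rw [add_assoc]; exact add_zero i] at h
    convert h using 1; ring
  · convert add_mem (monomial_mem_clusterSpan i p q) (monomial_mem_clusterSpan i (p + 1) q) using 1
    linear_combination cA i ^ p * cA (i + 1) ^ q * cA_exchange_add_four i

theorem cA_add_three_mul_mem (i : ZMod 5) (p q : ℕ) :
    cA (i + 3) * (cA i ^ p * cA (i + 1) ^ q) ∈ clusterSpan := by
  rcases p with _ | p
  · rcases q with _ | q
    · convert monomial_mem_clusterSpan (i + 3) 1 0 using 1; ring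
    · convert add_mem (monomial_mem_clusterSpan i 0 q) (cA_add_two_mul_mem i 0 q) using 1
      linear_combination cA (i + 1) ^ q * cA_exchange_add_one i
  · convert add_mem (monomial_mem_clusterSpan i p q) (cA_add_four_mul_mem i p q) using 1
    linear_combination cA i ^ p * cA (i + 1) ^ q * cA_exchange_add_three i

theorem cA_mul_mem_clusterSpan (j : ZMod 5) {s : K} (hs : s ∈ clusterSpan) :
    cA j * s ∈ clusterSpan := by
  induction hs using Submodule.span_induction with
  | mem x hx =>
    obtain ⟨i, p, q, rfl⟩ := hx
    rcases ZMod.five_eq_add i j with rfl | rfl | rfl | rfl | rfl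
    · convert monomial_mem_clusterSpan j (p + 1) q using 1; ring
    · convert monomial_mem_clusterSpan i p (q + 1) using 1; ring
    · exact cA_add_two_mul_mem i p q
    · exact cA_add_three_mul_mem i p q
    · exact cA_add_four_mul_mem i p q
  | zero => simp
  | add x y _ _ hx hy => rw [mul_add]; exact add_mem hx hy
  | smul n x _ hx => rw [mul_smul_comm]; exact Submodule.smul_mem _ n hx

theorem mem_clusterSpan_of_mem_closure {y : K} (hy : y ∈ Subring.closure (Set.range cA)) :
    y ∈ clusterSpan := by
  suffices h : ∀ s ∈ clusterSpan, y * s ∈ clusterSpan by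
    simpa using h 1 (by simpa using monomial_mem_clusterSpan 0 0 0)
  induction hy using Subring.closure_induction with
  | mem x hx =>
    obtain ⟨j, rfl⟩ := hx
    exact fun s hs => cA_mul_mem_clusterSpan j hs
  | zero => simp
  | one => simp
  | add x y _ _ hx hy =>
    intro s hs
    rw [add_mul]; exact add_mem (hx s hs) (hy s hs)
  | neg x _ hx =>
    intro s hs
    rw [neg_mul]; exact neg_mem (hx s hs)
  | mul x y _ _ hx hy =>
    intro s hs
    rw [mul_assoc]; exact hx _ (hy s hs)

/-! ### Algebraic independence of clusters -/

theorem isAlgebraic_of_isAlgebraic_a_b (S : Subalgebra ℚ K) (ha : IsAlgebraic S a)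
    (hb : IsAlgebraic S b) (z : K) : IsAlgebraic S z := by
  have hpoly : ∀ p : MvPolynomial (Fin 2) ℚ, IsAlgebraic S (algebraMap _ K p) := by
    intro p
    induction p using MvPolynomial.induction_on with
    | C r =>
      have h : algebraMap (MvPolynomial (Fin 2) ℚ) K (C r)
          = algebraMap S K (algebraMap ℚ S r) := by
        rw [← IsScalarTower.algebraMap_apply ℚ S K, ← MvPolynomial.algebraMap_eq,
          ← IsScalarTower.algebraMap_apply ℚ (MvPolynomial (Fin 2) ℚ) K]
      rw [h]
      exact isAlgebraic_algebraMap _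
    | add p q hp hq => rw [map_add]; exact hp.add hq
    | mul_X p i hp =>
      rw [map_mul]
      refine hp.mul ?_
      fin_cases i
      exacts [ha, hb]
  obtain ⟨p, q, -, rfl⟩ := IsFractionRing.div_surjective (A := MvPolynomial (Fin 2) ℚ) z
  rw [div_eq_mul_inv]
  exact (hpoly p).mul (hpoly q).inv

theorem two_le_trdeg : 2 ≤ Algebra.trdeg ℚ K := by
  have h : AlgebraicIndependent ℚ
      (algebraMap (MvPolynomial (Fin 2) ℚ) K ∘ (X : Fin 2 → MvPolynomial (Fin 2) ℚ)) :=
    (MvPolynomial.algebraicIndependent_X (Fin 2) ℚ).map'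
      (f := IsScalarTower.toAlgHom ℚ (MvPolynomial (Fin 2) ℚ) K) (IsFractionRing.injective _ _)
  simpa using h.cardinalMk_le_trdeg

theorem algebraicIndependent_cluster (i : ZMod 5) :
    AlgebraicIndependent ℚ ![cA i, cA (i + 1)] := by
  set S := Algebra.adjoin ℚ (Set.range ![cA i, cA (i + 1)])
  have hmem : ∀ x ∈ Set.range ![cA i, cA (i + 1)], IsAlgebraic S x := fun x hx =>
    isAlgebraic_algebraMap (⟨x, Algebra.subset_adjoin hx⟩ : S)
  have halg_one : IsAlgebraic S (1 : K) := isAlgebraic_one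
  have h0 : IsAlgebraic S (cA i) := hmem _ ⟨0, rfl⟩
  have h1 : IsAlgebraic S (cA (i + 1)) := hmem _ ⟨1, rfl⟩
  have h2 : IsAlgebraic S (cA (i + 2)) := by
    rw [eq_div_of_mul_eq (cA_ne_zero i) ((mul_comm _ _).trans (cA_exchange i)), div_eq_mul_inv]
    exact (halg_one.add h1).mul h0.inv
  have h4 : IsAlgebraic S (cA (i + 4)) := by
    rw [eq_div_of_mul_eq (cA_ne_zero _) (cA_exchange_add_four i), div_eq_mul_inv]
    exact (halg_one.add h0).mul h1.inv
  have h3 : IsAlgebraic S (cA (i + 3)) := by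
    rw [eq_div_of_mul_eq (cA_ne_zero _) (cA_exchange_add_three i), div_eq_mul_inv]
    exact (halg_one.add h4).mul h0.inv
  have hall : ∀ j, IsAlgebraic S (cA j) := by
    intro j
    rcases ZMod.five_eq_add i j with h | h | h | h | h <;> rw [h] <;> assumption
  have : Algebra.IsAlgebraic S K := ⟨isAlgebraic_of_isAlgebraic_a_b S (hall 1) (hall 2)⟩
  exact (Algebra.IsAlgebraic.isTranscendenceBasis_of_le_trdeg_of_finite ℚ _ (by simpa using two_le_trdeg)).1

/-! ### Laurent coefficients -/

/-- The exponent vector `(p, q)`. -/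
def expVec (p q : ℕ) : Fin 2 →₀ ℕ := Finsupp.single 0 p + Finsupp.single 1 q

@[simp] theorem expVec_zero (p q : ℕ) : expVec p q 0 = p := by simp [expVec]

@[simp] theorem expVec_one (p q : ℕ) : expVec p q 1 = q := by simp [expVec]

theorem expVec_add (p q p' q' : ℕ) :
    expVec p q + expVec p' q' = expVec (p + p') (q + q') := by
  ext i; fin_cases i <;> simp

theorem expVec_inj {p q p' q' : ℕ} : expVec p q = expVec p' q' ↔ p = p' ∧ q = q' := by
  refine ⟨fun h => ⟨?_, ?_⟩, fun h => by rw [h.1, h.2]⟩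
  · simpa using DFunLike.congr_fun h 0
  · simpa using DFunLike.congr_fun h 1

theorem aeval_monomial_expVec (u v : K) (p q : ℕ) :
    aeval ![u, v] (monomial (expVec p q) (1 : ℚ)) = u ^ p * v ^ q := by
  rw [aeval_monomial, Finsupp.prod_fintype _ _ (by simp)]
  simp

/-- `y` is a Laurent polynomial in `(u, v)` in which `u ^ p * v ^ q` has coefficient `r`. -/
def HasLaurentCoeff (u v : K) (p q : ℕ) (y : K) (r : ℚ) : Prop :=
  ∃ (k l : ℕ) (P : MvPolynomial (Fin 2) ℚ),
    y * u ^ k * v ^ l = aeval ![u, v] P ∧ P.coeff (expVec (p + k) (q + l)) = r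

namespace HasLaurentCoeff

variable {u v y z : K} {p q : ℕ} {r s : ℚ}

theorem raise_denom {k l : ℕ} {P : MvPolynomial (Fin 2) ℚ}
    (h : y * u ^ k * v ^ l = aeval ![u, v] P) (k' l' : ℕ) :
    y * u ^ (k + k') * v ^ (l + l')
        = aeval ![u, v] (P * monomial (expVec k' l') (1 : ℚ)) ∧
      (P * monomial (expVec k' l') (1 : ℚ)).coeff (expVec (p + (k + k')) (q + (l + l')))
        = P.coeff (expVec (p + k) (q + l)) := by
  constructor
  · rw [map_mul, ← h, aeval_monomial_expVec]; ring
  · rw [← add_assoc, ← add_assoc, ← expVec_add, coeff_mul_monomial, mul_one]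

/-- Two Laurent expansions can be brought to a common denominator. -/
theorem exists_common (hy : HasLaurentCoeff u v p q y r) (hz : HasLaurentCoeff u v p q z s) :
    ∃ (k l : ℕ) (P Q : MvPolynomial (Fin 2) ℚ),
      y * u ^ k * v ^ l = aeval ![u, v] P ∧ z * u ^ k * v ^ l = aeval ![u, v] Q ∧
      P.coeff (expVec (p + k) (q + l)) = r ∧ Q.coeff (expVec (p + k) (q + l)) = s := by
  obtain ⟨k, l, P, hP, rfl⟩ := hy
  obtain ⟨k', l', Q, hQ, rfl⟩ := hz
  obtain ⟨h1, h2⟩ := raise_denom (p := p) (q := q) hP k' l'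
  obtain ⟨h3, h4⟩ := raise_denom (p := p) (q := q) hQ k l
  rw [add_comm k' k, add_comm l' l] at h3 h4
  exact ⟨_, _, _, _, h1, h3, h2, h4⟩

theorem unique (huv : AlgebraicIndependent ℚ ![u, v]) (hy : HasLaurentCoeff u v p q y r)
    (hz : HasLaurentCoeff u v p q y s) : r = s := by
  obtain ⟨k, l, P, Q, hP, hQ, rfl, rfl⟩ := exists_common hy hz
  rw [huv (hP.symm.trans hQ)]

theorem zero : HasLaurentCoeff u v p q 0 0 := ⟨0, 0, 0, by simp, by simp⟩

theorem add (hy : HasLaurentCoeff u v p q y r) (hz : HasLaurentCoeff u v p q z s) :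
    HasLaurentCoeff u v p q (y + z) (r + s) := by
  obtain ⟨k, l, P, Q, hP, hQ, rfl, rfl⟩ := exists_common hy hz
  exact ⟨k, l, P + Q, by rw [map_add, ← hP, ← hQ]; ring, by simp⟩

theorem zsmul (n : ℤ) (hy : HasLaurentCoeff u v p q y r) :
    HasLaurentCoeff u v p q (n • y) (n * r) := by
  obtain ⟨k, l, P, hP, rfl⟩ := hy
  refine ⟨k, l, n • P, ?_, by rw [coeff_smul, zsmul_eq_mul]⟩
  rw [map_zsmul, ← hP, smul_mul_assoc, smul_mul_assoc]

theorem sum {ι : Type*} (t : Finset ι) (f : ι → K) (g : ι → ℚ)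
    (h : ∀ i ∈ t, HasLaurentCoeff u v p q (f i) (g i)) :
    HasLaurentCoeff u v p q (∑ i ∈ t, f i) (∑ i ∈ t, g i) := by
  classical
  induction t using Finset.induction_on with
  | empty => exact zero
  | insert i t hi ih =>
    rw [Finset.sum_insert hi, Finset.sum_insert hi]
    exact (h i (Finset.mem_insert_self i t)).add
      (ih fun j hj => h j (Finset.mem_insert_of_mem hj))

theorem monomial_self : HasLaurentCoeff u v p q (u ^ p * v ^ q) 1 :=
  ⟨0, 0, monomial (expVec p q) 1, by simp [aeval_monomial_expVec], by simp⟩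

theorem monomial_of_ne {p' q' : ℕ} (h : ¬(p' = p ∧ q' = q)) :
    HasLaurentCoeff u v p q (u ^ p' * v ^ q') 0 :=
  ⟨0, 0, monomial (expVec p' q') 1, by simp [aeval_monomial_expVec], by
    rw [coeff_monomial, if_neg]
    simpa [expVec_inj] using h⟩

/-- A coefficient vanishes if the numerator has too small a degree in `u`. -/
theorem of_degreeOf_zero_lt {k l : ℕ} {P : MvPolynomial (Fin 2) ℚ}
    (h : y * u ^ k * v ^ l = aeval ![u, v] P) (hP : P.degreeOf 0 < k) :
    HasLaurentCoeff u v p q y 0 :=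
  ⟨k, l, P, h, notMem_support_iff.1 <| notMem_support_of_degreeOf_lt 0 <| by
    rw [expVec_zero]; omega⟩

/-- A coefficient vanishes if the numerator has too small a degree in `v`. -/
theorem of_degreeOf_one_lt {k l : ℕ} {P : MvPolynomial (Fin 2) ℚ}
    (h : y * u ^ k * v ^ l = aeval ![u, v] P) (hP : P.degreeOf 1 < l) :
    HasLaurentCoeff u v p q y 0 :=
  ⟨k, l, P, h, notMem_support_iff.1 <| notMem_support_of_degreeOf_lt 1 <| by
    rw [expVec_one]; omega⟩

/-- A coefficient vanishes if the numerator has too small a total degree. -/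
theorem of_totalDegree_lt {k l : ℕ} {P : MvPolynomial (Fin 2) ℚ}
    (h : y * u ^ k * v ^ l = aeval ![u, v] P) (hP : P.totalDegree < k + l) :
    HasLaurentCoeff u v p q y 0 := by
  refine ⟨k, l, P, h, notMem_support_iff.1 fun hmem => ?_⟩
  have := le_totalDegree hmem
  rw [Finsupp.sum_fintype _ _ (by simp)] at this
  simp at this
  omega

end HasLaurentCoeff

theorem IsNonnegLaurent.exists_hasLaurentCoeff {u v y : K} (h : IsNonnegLaurent u v y) (p q : ℕ) :
    ∃ r : ℚ, 0 ≤ r ∧ HasLaurentCoeff u v p q y r := by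
  obtain ⟨k, l, P, hP⟩ := h
  refine ⟨((P.coeff (expVec (p + k) (q + l)) : ℕ) : ℚ), Nat.cast_nonneg _, k, l,
    map (Nat.castRingHom ℚ) P, ?_, ?_⟩
  · rw [hP, aeval_def, eval₂_map]
    congr 1
    exact Subsingleton.elim _ _
  · simp [coeff_map]

/-! ### Cluster monomials are proper Laurent monomials in the other clusters -/

theorem degreeOf_one_add_X_pow_eq_zero {i j : Fin 2} (hij : i ≠ j) (n : ℕ) :
    ((1 + X j : MvPolynomial (Fin 2) ℚ) ^ n).degreeOf i = 0 := by
  have h := degreeOf_pow_le i (1 + X j : MvPolynomial (Fin 2) ℚ) n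
  have h1 := degreeOf_add_le i (1 : MvPolynomial (Fin 2) ℚ) (X j)
  rw [degreeOf_one, degreeOf_X, if_neg hij, max_self, Nat.le_zero] at h1
  simpa [h1] using h

theorem degreeOf_one_add_X_add_X_pow_le (i : Fin 2) (n : ℕ) :
    ((1 + X 0 + X 1 : MvPolynomial (Fin 2) ℚ) ^ n).degreeOf i ≤ n := by
  refine (degreeOf_pow_le _ _ _).trans (mul_le_of_le_one_right (Nat.zero_le n) ?_)
  refine (degreeOf_add_le _ _ _).trans (max_le ((degreeOf_add_le _ _ _).trans (max_le ?_ ?_)) ?_)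
  · simp
  all_goals rw [degreeOf_X]; split_ifs <;> simp

theorem totalDegree_one_add_X_add_X_pow_le (n : ℕ) :
    ((1 + X 0 + X 1 : MvPolynomial (Fin 2) ℚ) ^ n).totalDegree ≤ n := by
  refine (totalDegree_pow _ _).trans (mul_le_of_le_one_right (Nat.zero_le n) ?_)
  refine (totalDegree_add _ _).trans (max_le ((totalDegree_add _ _).trans (max_le ?_ ?_)) ?_)
  all_goals simp

/-- A cluster monomial different from `c_i ^ p * c_{i+1} ^ q` does not involve the latter in its
Laurent expansion with respect to the cluster `(c_i, c_{i+1})`. -/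
theorem hasLaurentCoeff_zero_of_ne (i : ZMod 5) (p q : ℕ) {m : K} (hm : m ∈ clusterMonomials)
    (hne : m ≠ cA i ^ p * cA (i + 1) ^ q) :
    HasLaurentCoeff (cA i) (cA (i + 1)) p q m 0 := by
  have hinside : ∀ p' q', m = cA i ^ p' * cA (i + 1) ^ q' →
      HasLaurentCoeff (cA i) (cA (i + 1)) p q m 0 := by
    rintro p' q' rfl
    refine HasLaurentCoeff.monomial_of_ne ?_
    rintro ⟨rfl, rfl⟩
    exact hne rfl
  have h2 := cA_exchange i
  have h4 := cA_exchange_add_four i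
  have h3 : cA (i + 3) * (cA i * cA (i + 1)) = 1 + cA i + cA (i + 1) := by
    linear_combination cA i * cA_exchange_add_one i + cA_exchange i
  obtain ⟨j, s, t, rfl⟩ := hm
  rcases ZMod.five_eq_add i j with rfl | rfl | rfl | rfl | rfl
  · exact hinside s t rfl
  · rw [show i + 1 + 1 = i + 2 by rw [add_assoc]; rfl] at *
    rcases t.eq_zero_or_pos with rfl | ht
    · exact hinside 0 s (by simp)
    · refine .of_degreeOf_zero_lt (k := t) (l := 0) (P := X 1 ^ s * (1 + X 1) ^ t) ?_ ?_
      · simp [← h2, mul_pow]; ring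
      · refine (degreeOf_mul_le _ _ _).trans_lt ?_
        rw [degreeOf_one_add_X_pow_eq_zero (by decide)]
        have := degreeOf_pow_le 0 (X 1 : MvPolynomial (Fin 2) ℚ) s
        simp [degreeOf_X] at this
        omega
  · rw [show i + 2 + 1 = i + 3 by rw [add_assoc]; rfl] at *
    have key : cA (i + 2) ^ s * cA (i + 3) ^ t * cA i ^ (s + t) * cA (i + 1) ^ t
        = aeval ![cA i, cA (i + 1)] ((1 + X 1) ^ s * (1 + X 0 + X 1) ^ t : MvPolynomial _ ℚ) := by
      simp [← h2, ← h3, mul_pow]; ring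
    rcases s.eq_zero_or_pos with rfl | hs
    · rcases t.eq_zero_or_pos with rfl | ht
      · exact hinside 0 0 (by simp)
      · refine .of_totalDegree_lt key ?_
        have := totalDegree_one_add_X_add_X_pow_le t
        simp only [pow_zero, one_mul]
        omega
    · refine .of_degreeOf_zero_lt key ((degreeOf_mul_le _ _ _).trans_lt ?_)
      rw [degreeOf_one_add_X_pow_eq_zero (by decide)]
      have := degreeOf_one_add_X_add_X_pow_le 0 t
      omega
  · rw [show i + 3 + 1 = i + 4 by rw [add_assoc]; rfl] at *
    have key : cA (i + 3) ^ s * cA (i + 4) ^ t * cA i ^ s * cA (i + 1) ^ (s + t)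
        = aeval ![cA i, cA (i + 1)] ((1 + X 0) ^ t * (1 + X 0 + X 1) ^ s : MvPolynomial _ ℚ) := by
      simp [← h3, mul_pow]
      rw [← h4]; ring
    rcases t.eq_zero_or_pos with rfl | ht
    · rcases s.eq_zero_or_pos with rfl | hs
      · exact hinside 0 0 (by simp)
      · refine .of_totalDegree_lt key ?_
        have := totalDegree_one_add_X_add_X_pow_le s
        simp only [pow_zero, one_mul]
        omega
    · refine .of_degreeOf_one_lt key ((degreeOf_mul_le _ _ _).trans_lt ?_)
      rw [degreeOf_one_add_X_pow_eq_zero (by decide)]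
      have := degreeOf_one_add_X_add_X_pow_le 1 s
      omega
  · rw [show i + 4 + 1 = i by rw [add_assoc]; exact add_zero i] at *
    rcases s.eq_zero_or_pos with rfl | hs
    · exact hinside t 0 (by simp)
    · refine .of_degreeOf_one_lt (k := 0) (l := s) (P := X 0 ^ t * (1 + X 0) ^ s) ?_ ?_
      · simp
        rw [← h4]; ring
      · refine (degreeOf_mul_le _ _ _).trans_lt ?_
        rw [degreeOf_one_add_X_pow_eq_zero (by decide)]
        have := degreeOf_pow_le 1 (X 0 : MvPolynomial (Fin 2) ℚ) t
        simp [degreeOf_X] at this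
        omega

/-- In a `ℤ`-linear combination of cluster monomials, the multiplicity of `c_i ^ p * c_{i+1} ^ q`
is its coefficient in the Laurent expansion with respect to `(c_i, c_{i+1})`. -/
theorem hasLaurentCoeff_sum (n : K →₀ ℤ) (hn : ↑n.support ⊆ clusterMonomials)
    (i : ZMod 5) (p q : ℕ) :
    HasLaurentCoeff (cA i) (cA (i + 1)) p q (n.sum fun m k => k • m)
      (n (cA i ^ p * cA (i + 1) ^ q)) := by
  classical
  set m₀ := cA i ^ p * cA (i + 1) ^ q
  have h := HasLaurentCoeff.sum (u := cA i) (v := cA (i + 1)) (p := p) (q := q) n.support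
    (fun m => n m • m) (fun m => if m = m₀ then (n m : ℚ) else 0) fun m hm => by
      split_ifs with h
      · subst h
        simpa using HasLaurentCoeff.monomial_self.zsmul (n m₀)
      · simpa using (hasLaurentCoeff_zero_of_ne i p q (hn hm) h).zsmul (n m)
  rw [Finset.sum_ite_eq'] at h
  convert h using 1
  · rfl
  · split_ifs with h0
    · rfl
    · simpa using h0

/-- Property (A3) in type `A_2`: if `y` belongs to the cluster algebra `A`
(the subring of `K` generated by `c_1, …, c_5`) and `y` is a nonnegative Laurent
polynomial in every cluster `(c_i, c_{i+1})`, then `y` is a finite `ℕ`-linear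
combination of cluster monomials. -/
theorem typeA_positive_elements_are_nonneg_combinations (y : K)
    (hy : y ∈ Subring.closure (Set.range cA))
    (hpos : ∀ i : ZMod 5, IsNonnegLaurent (cA i) (cA (i + 1)) y) :
    ∃ c : K →₀ ℕ, ↑c.support ⊆ clusterMonomials ∧
      y = c.sum fun e k => (k : K) * e := by
  obtain ⟨n, hn, rfl⟩ := Submodule.mem_span_set.1 (mem_clusterSpan_of_mem_closure hy)
  have hnonneg : ∀ m, 0 ≤ n m := by
    intro m
    by_cases hm : m ∈ n.support
    · obtain ⟨i, p, q, rfl⟩ := hn hm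
      obtain ⟨r, hr, hcoeff⟩ := (hpos i).exists_hasLaurentCoeff p q
      have := (hasLaurentCoeff_sum n hn i p q).unique (algebraicIndependent_cluster i) hcoeff
      exact_mod_cast this ▸ hr
    · rw [Finsupp.notMem_support_iff.1 hm]
  refine ⟨n.mapRange Int.toNat rfl, ?_, ?_⟩
  · exact subset_trans (Finset.coe_subset.2 Finsupp.support_mapRange) hn
  · rw [Finsupp.sum_mapRange_index (by simp)]
    refine Finsupp.sum_congr fun m _ => ?_
    rw [zsmul_eq_mul]
    congr 1
    exact_mod_cast congrArg (Int.cast : ℤ → K) (Int.toNat_of_nonneg (hnonneg m)).symm
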